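/- arXiv:2605.06824 — 4 statements merged into one kernel-verified Lean document; each statement's English description precedes it below -/
import Mathlib

section
/- Let Γ be a plumbing tree with framing matrix B, let v_i and v_j be adjacent vertices of Γ with weights m_1 and m_2, and let Γ∘ be the plumbing tree obtained from Γ by the move (A+): the edge between v_i and v_j is subdivided by a new vertex w of weight +1, and the weights of v_i and v_j are changed to m_1 + 1 and m_2 + 1 respectively (all other vertices, weights, and edges unchanged). If B∘ denotes the framing matrix of Γ∘, then n_+(B∘) = n_+(B) + 1 and n_-(B∘) = n_-(B). -/
/-- A plumbing tree: a finite tree with integer vertex weights (Euler numbers). -/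
structure PlumbingTree (V : Type) [Fintype V] where
  adj : SimpleGraph V
  isTree : adj.IsTree
  weight : V → ℤ

open Classical in
/-- The framing matrix of a plumbing tree, viewed as a real symmetric matrix. -/
noncomputable def framing {V : Type} [Fintype V] (Γ : PlumbingTree V) :
    Matrix V V ℝ :=
  Matrix.of fun i j =>
    if i = j then (Γ.weight i : ℝ) else if Γ.adj.Adj i j then 1 else 0

/-- The number of positive eigenvalues (with multiplicity) of a symmetric real matrix. -/
noncomputable def nPos {V : Type} [Fintype V] [DecidableEq V] (A : Matrix V V ℝ) : ℕ :=
  if h : A.IsHermitian then Nat.card {i // 0 < h.eigenvalues i} else 0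

/-- The number of negative eigenvalues (with multiplicity) of a symmetric real matrix. -/
noncomputable def nNeg {V : Type} [Fintype V] [DecidableEq V] (A : Matrix V V ℝ) : ℕ :=
  if h : A.IsHermitian then Nat.card {i // h.eigenvalues i < 0} else 0

open Matrix in
/-- A real symmetric matrix is diagonalised, as a quadratic form, by its eigenvalues. -/
lemma exists_injective_diagonalization {V : Type} [Fintype V] [DecidableEq V]
    {A : Matrix V V ℝ} (h : A.IsHermitian) :
    ∃ L : (V → ℝ) →ₗ[ℝ] (V → ℝ), Function.Injective L ∧
      ∀ x, x ⬝ᵥ A *ᵥ x = ∑ i, h.eigenvalues i * (L x i * L x i) := by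
  set U : Matrix V V ℝ := h.eigenvectorUnitary.1
  have hA : A = U * diagonal h.eigenvalues * Uᵀ := by
    have := h.spectral_theorem
    rw [Unitary.conjStarAlgAut_apply] at this
    exact this
  have hUU : U * Uᵀ = 1 := (Unitary.mem_iff.mp h.eigenvectorUnitary.2).2
  refine ⟨Uᵀ.mulVecLin, fun x y hxy => ?_, fun x => ?_⟩
  · have := congrArg (U *ᵥ ·) hxy
    simpa only [mulVecLin_apply, mulVec_mulVec, hUU, one_mulVec] using this
  · have hx : x ⬝ᵥ A *ᵥ x = (Uᵀ *ᵥ x) ⬝ᵥ diagonal h.eigenvalues *ᵥ (Uᵀ *ᵥ x) := by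
      conv_lhs => rw [hA]
      rw [← mulVec_mulVec, ← mulVec_mulVec, dotProduct_mulVec, ← mulVec_transpose]
    rw [hx]
    simp only [dotProduct, mulVec_diagonal, mulVecLin_apply]
    exact Finset.sum_congr rfl fun i _ => by ring

open Matrix in
lemma equivalent_weightedSumSquares_of_injective {V ι : Type} [Fintype V] [DecidableEq V]
    [Fintype ι] {A : Matrix V V ℝ} {c : ι → ℝ} (L : (V → ℝ) →ₗ[ℝ] (ι → ℝ))
    (hL : Function.Injective L) (hcard : Fintype.card V = Fintype.card ι)
    (hA : ∀ x, x ⬝ᵥ A *ᵥ x = ∑ i, c i * (L x i * L x i)) :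
    A.toQuadraticForm'.Equivalent (QuadraticMap.weightedSumSquares ℝ c) := by
  refine ⟨⟨LinearEquiv.ofInjectiveOfFinrankEq L hL (by simpa using hcard), fun x => ?_⟩⟩
  simp [QuadraticMap.weightedSumSquares_apply, toQuadraticForm', toLinearMap₂'_apply', hA]

open Matrix in
/-- **Sylvester's law of inertia** for the eigenvalue counts of a real symmetric matrix. -/
lemma nPos_nNeg_eq_ncard {V ι : Type} [Fintype V] [DecidableEq V]
    [Fintype ι] {A : Matrix V V ℝ} (h : A.IsHermitian) {c : ι → ℝ}
    (L : (V → ℝ) →ₗ[ℝ] (ι → ℝ))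
    (hL : Function.Injective L) (hcard : Fintype.card V = Fintype.card ι)
    (hA : ∀ x, x ⬝ᵥ A *ᵥ x = ∑ i, c i * (L x i * L x i)) :
    nPos A = {i | 0 < c i}.ncard ∧ nNeg A = {i | c i < 0}.ncard := by
  obtain ⟨M, hM, hAM⟩ := exists_injective_diagonalization h
  have hc := equivalent_weightedSumSquares_of_injective L hL hcard hA
  have he := equivalent_weightedSumSquares_of_injective M hM rfl hAM
  rw [← QuadraticForm.sigPos_of_equiv_weightedSumSquares hc,
    ← QuadraticForm.sigNeg_of_equiv_weightedSumSquares hc,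
    QuadraticForm.sigPos_of_equiv_weightedSumSquares he,
    QuadraticForm.sigNeg_of_equiv_weightedSumSquares he]
  simp only [nPos, nNeg, dif_pos h]
  exact ⟨rfl, rfl⟩

lemma framing_isHermitian {V : Type} [Fintype V] (Γ : PlumbingTree V) :
    (framing Γ).IsHermitian := by
  ext i j
  simp only [framing, Matrix.conjTranspose_apply, Matrix.of_apply, star_trivial]
  by_cases h : i = j
  · simp [h]
  · rw [if_neg h, if_neg (Ne.symm h)]
    congr 1
    exact propext (Γ.adj.adj_comm j i)

/-- In an acyclic graph, there is a vertex sign that changes across one given edge only. -/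
lemma SimpleGraph.IsAcyclic.exists_sign {V : Type} {G : SimpleGraph V} (hG : G.IsAcyclic)
    {u v : V} (huv : G.Adj u v) :
    ∃ ε : V → ℝ, (∀ a, ε a * ε a = 1) ∧ ε u * ε v = -1 ∧
      ∀ a b, G.Adj a b → ¬(a = u ∧ b = v) → ¬(a = v ∧ b = u) → ε a * ε b = 1 := by
  classical
  have hbr : ¬(G.deleteEdges {s(u, v)}).Reachable u v :=
    SimpleGraph.isBridge_iff.mp (SimpleGraph.isAcyclic_iff_forall_adj_isBridge.mp hG huv)
  refine ⟨fun a => if (G.deleteEdges {s(u, v)}).Reachable u a then 1 else -1, fun a => ?_, ?_,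
    fun a b hab h₁ h₂ => ?_⟩
  · dsimp only
    split_ifs <;> norm_num
  · simp [hbr]
  · have hab' : (G.deleteEdges {s(u, v)}).Adj a b := by
      simp only [SimpleGraph.deleteEdges_adj, Set.mem_singleton_iff, Sym2.eq_iff]
      tauto
    have hiff : (G.deleteEdges {s(u, v)}).Reachable u a ↔
        (G.deleteEdges {s(u, v)}).Reachable u b :=
      ⟨fun h => h.trans hab'.reachable, fun h => h.trans hab'.symm.reachable⟩
    simp only [hiff]
    split_ifs <;> norm_num

/-- **Neumann move (A+) and the signature.**
If `Γ'` is obtained from the plumbing tree `Γ` by the move (A+) — the edge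
between adjacent vertices `vi`, `vj` is subdivided by a new vertex `w` of
weight `+1`, and the weights of `vi`, `vj` each increase by `1`, everything else
unchanged — then `n₊(B∘) = n₊(B) + 1` and `n₋(B∘) = n₋(B)` for the framing
matrices. -/
theorem neumann_move_A_pos_signature
    {V W : Type} [Fintype V] [DecidableEq V] [Fintype W] [DecidableEq W]
    (Γ : PlumbingTree V) (Γ' : PlumbingTree W)
    (vi vj : V) (hadj : Γ.adj.Adj vi vj)
    (f : V → W) (w : W)
    (hf : Function.Injective f)
    (hw : ∀ v, f v ≠ w)
    (hsurj : ∀ x : W, x = w ∨ ∃ v, f v = x)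
    (hwi : Γ'.weight (f vi) = Γ.weight vi + 1)
    (hwj : Γ'.weight (f vj) = Γ.weight vj + 1)
    (hwother : ∀ v, v ≠ vi → v ≠ vj → Γ'.weight (f v) = Γ.weight v)
    (hww : Γ'.weight w = 1)
    (hadjw : ∀ v, Γ'.adj.Adj w (f v) ↔ (v = vi ∨ v = vj))
    (hadjf : ∀ a b, Γ'.adj.Adj (f a) (f b) ↔
      (Γ.adj.Adj a b ∧ ¬(a = vi ∧ b = vj) ∧ ¬(a = vj ∧ b = vi))) :
    nPos (framing Γ') = nPos (framing Γ) + 1 ∧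
    nNeg (framing Γ') = nNeg (framing Γ) := by
  classical
  obtain ⟨ε, hε, hεij, hεadj⟩ := Γ.isTree.isAcyclic.exists_sign hadj
  obtain ⟨L, hL, hQ⟩ := exists_injective_diagonalization (framing_isHermitian Γ)
  set c := (framing_isHermitian Γ).eigenvalues
  obtain ⟨hpos, hneg⟩ := nPos_nNeg_eq_ncard (framing_isHermitian Γ) L hL rfl hQ
  let u : V → ℝ := fun a => if a = vi ∨ a = vj then 1 else 0
  have hne : vi ≠ vj := hadj.ne
  have hB : ∀ a b, framing Γ' (f a) (f b) = u a * u b + ε a * ε b * framing Γ a b := by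
    intro a b
    simp only [framing, Matrix.of_apply, hf.eq_iff, hadjf, u]
    by_cases hab : a = b
    · subst hab
      by_cases hai : a = vi
      · subst hai; simp [hwi, hε]; ring
      by_cases haj : a = vj
      · subst haj; simp [hwj, hε]; ring
      simp [hai, haj, hε, hwother a hai haj]
    · by_cases h₁ : a = vi ∧ b = vj
      · obtain ⟨rfl, rfl⟩ := h₁
        simp [hne, hadj, hεij]
      by_cases h₂ : a = vj ∧ b = vi
      · obtain ⟨rfl, rfl⟩ := h₂
        simp [hne.symm, hadj.symm, mul_comm (ε a), hεij]
      have h₃ : ¬((a = vi ∨ a = vj) ∧ (b = vi ∨ b = vj)) := by grind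
      rw [ite_zero_mul_ite_zero, if_neg h₃]
      by_cases hG : Γ.adj.Adj a b
      · simp [hab, h₁, h₂, hG, hεadj a b hG h₁ h₂]
      · simp [hab, hG]
  have hBw : ∀ a, framing Γ' w (f a) = u a := by
    intro a
    simp [framing, (hw a).symm, hadjw, u]
  have hBw' : ∀ a, framing Γ' (f a) w = u a := by
    intro a
    rw [← hBw, ← (framing_isHermitian Γ').apply, star_trivial]
  have hBww : framing Γ' w w = 1 := by simp [framing, hww]
  let g : Option V → W := fun o => o.elim w f
  have hg : Function.Bijective g := by
    constructor
    · rintro (_ | a) (_ | b) hab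
      · rfl
      · exact (hw b hab.symm).elim
      · exact (hw a hab).elim
      · exact congrArg some (hf hab)
    · intro x
      obtain rfl | ⟨v, rfl⟩ := hsurj x
      exacts [⟨none, rfl⟩, ⟨some v, rfl⟩]
  have hsum : ∀ F : W → ℝ, ∑ x, F x = F w + ∑ v, F (f v) := fun F => by
    rw [← hg.sum_comp F, Fintype.sum_option]
    rfl
  let D : (W → ℝ) →ₗ[ℝ] (V → ℝ) := LinearMap.pi fun v => ε v • LinearMap.proj (f v)
  let T : (W → ℝ) →ₗ[ℝ] ℝ := LinearMap.proj w + ∑ v, u v • LinearMap.proj (f v)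
  let L' : (W → ℝ) →ₗ[ℝ] (Option V → ℝ) :=
    LinearMap.pi fun o => o.elim T fun v => LinearMap.proj v ∘ₗ L ∘ₗ D
  have hDv : ∀ y v, D y v = ε v * y (f v) := fun y v => rfl
  have hT : ∀ y, T y = y w + ∑ v, u v * y (f v) := fun y => by simp [T]
  have hL'n : ∀ y, L' y none = T y := fun y => rfl
  have hL's : ∀ y v, L' y (some v) = L (D y) v := fun y v => rfl
  have hL' : Function.Injective L' := by
    rw [injective_iff_map_eq_zero]
    intro y hy
    have hD : D y = 0 := (injective_iff_map_eq_zero L).mp hL _ <| funext fun v => by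
      rw [← hL's, hy]; rfl
    have hyf : ∀ v, y (f v) = 0 := fun v => by
      have h0 : ε v * y (f v) = 0 := by rw [← hDv, hD]; rfl
      have := hε v
      grind
    have hyw : y w = 0 := by
      have h0 : T y = 0 := by rw [← hL'n, hy]; rfl
      simpa [hT, hyf] using h0
    funext x
    obtain rfl | ⟨v, rfl⟩ := hsurj x
    exacts [hyw, hyf v]
  let c' : Option V → ℝ := fun o => o.elim 1 c
  have hQ' : ∀ y, y ⬝ᵥ (framing Γ').mulVec y = ∑ o, c' o * (L' y o * L' y o) := by
    intro y
    have hD := hQ (D y)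
    rw [Fintype.sum_option]
    simp only [hL'n, hL's, c', Option.elim, ← hD]
    simp only [dotProduct, Matrix.mulVec, hsum, hB, hBw, hBw', hBww, hT, hDv]
    have hsq : (∑ v, u v * y (f v)) * (∑ v, u v * y (f v)) =
        ∑ a, y (f a) * ∑ b, u a * u b * y (f b) := by
      rw [Finset.sum_mul]
      refine Finset.sum_congr rfl fun a _ => ?_
      rw [Finset.mul_sum, Finset.mul_sum]
      exact Finset.sum_congr rfl fun b _ => by ring
    have hεQ : ∑ a, ε a * y (f a) * ∑ b, framing Γ a b * (ε b * y (f b)) =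
        ∑ a, y (f a) * ∑ b, ε a * ε b * framing Γ a b * y (f b) := by
      refine Finset.sum_congr rfl fun a _ => ?_
      rw [Finset.mul_sum, Finset.mul_sum]
      exact Finset.sum_congr rfl fun b _ => by ring
    have hlin : ∑ a, y (f a) * (u a * y w) = y w * ∑ v, u v * y (f v) := by
      rw [Finset.mul_sum]
      exact Finset.sum_congr rfl fun b _ => by ring
    simp only [add_mul, mul_add, Finset.sum_add_distrib, hεQ, hlin, hsq]
    ring
  have hcard : Fintype.card W = Fintype.card (Option V) := (Fintype.card_of_bijective hg).symm
  obtain ⟨hpos', hneg'⟩ := nPos_nNeg_eq_ncard (framing_isHermitian Γ') L' hL' hcard hQ'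
  have hp : {o | 0 < c' o} = insert none (some '' {v | 0 < c v}) := by
    ext (_ | v) <;> simp [c']
  have hn : {o | c' o < 0} = some '' {v | c v < 0} := by
    ext (_ | v) <;> simp [c', zero_le_one]
  rw [hpos, hneg, hpos', hneg', hp, hn, Set.ncard_insert_of_notMem (by simp),
    Set.ncard_image_of_injective _ (Option.some_injective V),
    Set.ncard_image_of_injective _ (Option.some_injective V)]
  exact ⟨rfl, rfl⟩
end

section
/- Let B be a symmetric s×s rational matrix and let i, j be distinct indices such that the i-th row of B satisfies B_{ii} = 0, B_{ij} = B_{ji} = 1, and B_{ik} = 0 for all k ∉ {i, j} (i.e., i is a leaf of weight 0 attached to j). Let B' be the matrix obtained from B by: setting B'_{ii} = 1 and B'_{jj} = −1, and setting B'_{jk} = B'_{kj} = 0 for every k ≠ j (so the vertex j is fully decoupled), all other entries unchanged. Then B' is congruent to B; in particular n_+(B') = n_+(B) and n_-(B') = n_-(B). -/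
open Matrix

/-- The number of positive eigenvalues (with multiplicity) of a symmetric
rational matrix, computed via the associated real symmetric matrix. -/
noncomputable def nPosQ {V : Type} [Fintype V] [DecidableEq V] (A : Matrix V V ℚ) : ℕ :=
  if h : (A.map ((↑) : ℚ → ℝ)).IsHermitian then Nat.card {i // 0 < h.eigenvalues i} else 0

/-- The number of negative eigenvalues (with multiplicity) of a symmetric
rational matrix, computed via the associated real symmetric matrix. -/
noncomputable def nNegQ {V : Type} [Fintype V] [DecidableEq V] (A : Matrix V V ℚ) : ℕ :=
  if h : (A.map ((↑) : ℚ → ℝ)).IsHermitian then Nat.card {i // h.eigenvalues i < 0} else 0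

namespace Matrix

theorem toQuadraticForm'_apply {R n : Type*} [CommRing R] [Fintype n] [DecidableEq n]
    (M : Matrix n n R) (x : n → R) : M.toQuadraticForm' x = x ⬝ᵥ M *ᵥ x := by
  simp [toQuadraticForm', Matrix.toLinearMap₂'_apply']

theorem toQuadraticForm'_equivalent_of_congruent {R n : Type*} [CommRing R] [Fintype n]
    [DecidableEq n] {A L : Matrix n n R} (hL : IsUnit L.det) :
    (L * A * Lᵀ).toQuadraticForm'.Equivalent A.toQuadraticForm' := by
  have hT : IsUnit Lᵀ := by rwa [isUnit_iff_isUnit_det, det_transpose]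
  let e := hT.invertible
  refine ⟨⟨Lᵀ.toLinearEquiv' e, fun x ↦ ?_⟩⟩
  change A.toQuadraticForm' (Lᵀ *ᵥ x) = _
  rw [toQuadraticForm'_apply, toQuadraticForm'_apply, ← mulVec_mulVec, ← mulVec_mulVec,
    dotProduct_mulVec x L, ← mulVec_transpose]

theorem IsHermitian.toQuadraticForm'_equivalent_weightedSumSquares {n : Type*} [Fintype n]
    [DecidableEq n] {A : Matrix n n ℝ} (hA : A.IsHermitian) :
    A.toQuadraticForm'.Equivalent (QuadraticMap.weightedSumSquares ℝ hA.eigenvalues) := by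
  have hdet : IsUnit (hA.eigenvectorUnitary : Matrix n n ℝ).det :=
    (isUnit_iff_isUnit_det _).mp Unitary.isUnit_coe
  have hspec : A = (hA.eigenvectorUnitary : Matrix n n ℝ) * diagonal hA.eigenvalues *
      (hA.eigenvectorUnitary : Matrix n n ℝ)ᵀ := by
    have h := hA.spectral_theorem
    rwa [Unitary.conjStarAlgAut_apply, star_eq_conjTranspose, conjTranspose_eq_transpose_of_trivial]
      at h
  have hdiag : (diagonal hA.eigenvalues).toQuadraticForm' =
      QuadraticMap.weightedSumSquares ℝ hA.eigenvalues := by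
    ext x
    simp only [toQuadraticForm'_apply, dotProduct, mulVec_diagonal,
      QuadraticMap.weightedSumSquares_apply, smul_eq_mul]
    exact Finset.sum_congr rfl fun i _ ↦ by ring
  have h := toQuadraticForm'_equivalent_of_congruent (A := diagonal hA.eigenvalues) hdet
  rwa [← hspec, hdiag] at h

end Matrix

theorem isHermitian_map_ratCast {V : Type} {A : Matrix V V ℚ} (hA : A.IsSymm) :
    (A.map ((↑) : ℚ → ℝ)).IsHermitian := by
  rw [IsHermitian, conjTranspose_eq_transpose_of_trivial]
  exact hA.map _

theorem nPosQ_eq_sigPos {V : Type} [Fintype V] [DecidableEq V] {A : Matrix V V ℚ}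
    (hA : A.IsSymm) : nPosQ A = sigPos (A.map ((↑) : ℚ → ℝ)).toQuadraticForm' := by
  have h := isHermitian_map_ratCast hA
  rw [nPosQ, dif_pos h, QuadraticForm.sigPos_of_equiv_weightedSumSquares
    h.toQuadraticForm'_equivalent_weightedSumSquares]
  rfl

theorem nNegQ_eq_sigNeg {V : Type} [Fintype V] [DecidableEq V] {A : Matrix V V ℚ}
    (hA : A.IsSymm) : nNegQ A = sigNeg (A.map ((↑) : ℚ → ℝ)).toQuadraticForm' := by
  have h := isHermitian_map_ratCast hA
  rw [nNegQ, dif_pos h, QuadraticForm.sigNeg_of_equiv_weightedSumSquares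
    h.toQuadraticForm'_equivalent_weightedSumSquares]
  rfl

/-- **Sylvester's law of inertia** for rational matrices. -/
theorem nPosQ_nNegQ_eq_of_congruent {V : Type} [Fintype V] [DecidableEq V] {A L : Matrix V V ℚ}
    (hA : A.IsSymm) (hL : IsUnit L.det) :
    nPosQ (L * A * Lᵀ) = nPosQ A ∧ nNegQ (L * A * Lᵀ) = nNegQ A := by
  have hLA : (L * A * Lᵀ).IsSymm := by
    rw [IsSymm, transpose_mul, transpose_mul, transpose_transpose, hA.eq, Matrix.mul_assoc]
  have hdet : IsUnit (L.map (Rat.castHom ℝ)).det := by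
    rw [← RingHom.mapMatrix_apply, ← RingHom.map_det]
    exact hL.map _
  have hmap : (L * A * Lᵀ).map ((↑) : ℚ → ℝ) = L.map (Rat.castHom ℝ) *
      A.map ((↑) : ℚ → ℝ) * (L.map (Rat.castHom ℝ))ᵀ := by
    change (L * A * Lᵀ).map (Rat.castHom ℝ) = _
    rw [Matrix.map_mul, Matrix.map_mul, transpose_map]
    rfl
  have he := toQuadraticForm'_equivalent_of_congruent (A := A.map ((↑) : ℚ → ℝ)) hdet
  rw [← hmap] at he
  rw [nPosQ_eq_sigPos hLA, nPosQ_eq_sigPos hA, nNegQ_eq_sigNeg hLA, nNegQ_eq_sigNeg hA]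
  exact ⟨he.sigPos_eq, he.sigNeg_eq⟩

/-- The coefficient of `e_i` added to each basis vector by `leafChange`. -/
def leafCoeff {V : Type*} [DecidableEq V] (B : Matrix V V ℚ) (i j a : V) : ℚ :=
  if a = i then (1 - B j j) / 2 else if a = j then (-1 - B j j) / 2 else -B j a

/-- The change of basis that sends `e_i`, `e_j` to a basis of norms `1`, `-1` of the hyperbolic
plane they span, and clears the remaining entries of row and column `j`. -/
def leafChange {V : Type*} [DecidableEq V] (B : Matrix V V ℚ) (i j : V) : Matrix V V ℚ :=
  of fun a b ↦ leafCoeff B i j a * (if b = i then 1 else 0) +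
    (if b = (if a = i then j else a) then 1 else 0)

/-- The inverse of `leafChange`. -/
def leafChangeInv {V : Type*} [DecidableEq V] (B : Matrix V V ℚ) (i j : V) : Matrix V V ℚ :=
  of fun a b ↦
    (if a = i then 1 else if a = j then (1 + B j j) / 2 else B j a) *
      ((if b = i then 1 else 0) - (if b = j then 1 else 0)) +
      (if a = i then 0 else if b = a then 1 else 0)

theorem leafChange_mul_apply {V : Type*} [Fintype V] [DecidableEq V] (B M : Matrix V V ℚ)
    (i j a k : V) :
    (leafChange B i j * M) a k =
      leafCoeff B i j a * M i k + M (if a = i then j else a) k := by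
  simp only [mul_apply, leafChange, of_apply, add_mul, mul_assoc, Finset.sum_add_distrib,
    ← Finset.mul_sum, ite_mul, one_mul, zero_mul, Finset.sum_ite_eq', Finset.mem_univ, if_true]

theorem isUnit_det_leafChange {V : Type*} [Fintype V] [DecidableEq V] (B : Matrix V V ℚ) {i j : V}
    (hij : i ≠ j) : IsUnit (leafChange B i j).det := by
  rw [← isUnit_iff_isUnit_det]
  refine IsUnit.of_mul_eq_one (leafChangeInv B i j) ?_
  ext a b
  rw [leafChange_mul_apply]
  simp only [leafCoeff, leafChangeInv, of_apply, one_apply]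
  grind

theorem leafChange_congruence_apply {V : Type*} [Fintype V] [DecidableEq V] (B : Matrix V V ℚ)
    (i j a b : V) :
    (leafChange B i j * B * (leafChange B i j)ᵀ) a b =
      leafCoeff B i j b * (leafCoeff B i j a * B i i + B (if a = i then j else a) i) +
        (leafCoeff B i j a * B i (if b = i then j else b) +
          B (if a = i then j else a) (if b = i then j else b)) := by
  rw [← transpose_apply (_ * _), transpose_mul, transpose_transpose, leafChange_mul_apply]
  simp only [transpose_apply, leafChange_mul_apply]

/-- **Case 2 of the Duchon–Eisenbud–Neumann diagonalization algorithm.**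
Let `B` be a symmetric rational matrix and `i ≠ j` indices such that `i` is a
leaf of weight `0` attached to `j`: `B i i = 0`, `B i j = B j i = 1` and
`B i k = 0` for `k ∉ {i, j}`.  Let `B'` be obtained from `B` by setting
`B' i i = 1`, `B' j j = -1`, and decoupling `j` completely
(`B' j k = B' k j = 0` for all `k ≠ j`), all other entries unchanged.
Then `B'` is congruent to `B`; in particular `n₊(B') = n₊(B)` and
`n₋(B') = n₋(B)`. -/
theorem diagonalization_case_two
    {s : ℕ} (B B' : Matrix (Fin s) (Fin s) ℚ) (hB : B.IsSymm)
    (i j : Fin s) (hij : i ≠ j)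
    (hii : B i i = 0) (hij1 : B i j = 1) (hji1 : B j i = 1)
    (hik : ∀ k, k ≠ i → k ≠ j → B i k = 0)
    (hB'i : B' i i = 1) (hB'j : B' j j = -1)
    (hB'jk : ∀ k, k ≠ j → B' j k = 0 ∧ B' k j = 0)
    (hB'other : ∀ a b, a ≠ j → b ≠ j → ¬(a = i ∧ b = i) → B' a b = B a b) :
    (∃ L : Matrix (Fin s) (Fin s) ℚ, IsUnit L.det ∧ B' = L * B * Lᵀ) ∧
    nPosQ B' = nPosQ B ∧ nNegQ B' = nNegQ B := by
  have hL := isUnit_det_leafChange B hij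
  have hB' : B' = leafChange B i j * B * (leafChange B i j)ᵀ := by
    ext a b
    rw [leafChange_congruence_apply]
    simp only [leafCoeff]
    have hs : ∀ x y, B x y = B y x := fun x y ↦ hB.apply y x
    grind
  refine ⟨⟨_, hL, hB'⟩, ?_⟩
  rw [hB']
  exact nPosQ_nNegQ_eq_of_congruent hB hL
end

section
/- Let a_0, a_1, …, a_n be rational numbers and let T be the (n+1)×(n+1) symmetric tridiagonal matrix with diagonal entries a_0, …, a_n and all sub- and super-diagonal entries equal to 1. Suppose that for every i with 0 ≤ i ≤ n the negative continued fraction ⟦a_i, a_{i+1}, …, a_n⟧ is defined. Then T is negative definite if and only if ⟦a_i, a_{i+1}, …, a_n⟧ < 0 for every i with 0 ≤ i ≤ n. -/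
open Matrix

/-- The negative continued fraction ⟦a₀, …, aₙ⟧ of a list of rationals:
⟦aₙ⟧ = aₙ and ⟦aᵢ, …, aₙ⟧ = aᵢ − 1/⟦aᵢ₊₁, …, aₙ⟧, returning `none`
whenever a division by zero occurs (or the list is empty). -/
def ncf : List ℚ → Option ℚ
  | [] => none
  | [a] => some a
  | a :: b :: l =>
    (ncf (b :: l)).bind fun x => if x = 0 then none else some (a - 1 / x)

/-- The framing matrix of a linear plumbing chain with weights given by the
list `l`: a symmetric tridiagonal matrix with diagonal `l` and all sub- and
super-diagonal entries equal to `1`. -/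
def tridiagL (l : List ℚ) : Matrix (Fin l.length) (Fin l.length) ℚ :=
  Matrix.of fun i j =>
    if i = j then l.get i
    else if (i : ℕ) + 1 = (j : ℕ) ∨ (j : ℕ) + 1 = (i : ℕ) then 1 else 0

/-- The eigenvalues of a symmetric rational matrix, as real numbers (junk value
`0` if the matrix is not symmetric). -/
noncomputable def eigsR {V : Type} [Fintype V] [DecidableEq V] (A : Matrix V V ℚ) : V → ℝ :=
  if h : (A.map ((↑) : ℚ → ℝ)).IsHermitian then h.eigenvalues else 0

/-- A symmetric rational matrix is negative definite iff all of its eigenvalues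
are strictly negative. -/
def IsNegDefQ {V : Type} [Fintype V] [DecidableEq V] (A : Matrix V V ℚ) : Prop :=
  ∀ i, eigsR A i < 0

/-- The unit lower bidiagonal factor of the decomposition `T = Lᵀ D L` of a tridiagonal matrix
with off-diagonal entries `1` and pivots `d`. -/
def bidiagL {n : ℕ} (d : Fin n → ℚ) : Matrix (Fin n) (Fin n) ℚ :=
  Matrix.of fun k i => (if k = i then 1 else 0) + if (k : ℕ) = i + 1 then 1 / d k else 0

theorem det_bidiagL {n : ℕ} (d : Fin n → ℚ) : (bidiagL d).det = 1 := by
  rw [Matrix.det_of_isLowerTriangular]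
  · simp [bidiagL]
  · intro i j hij
    have hij : i < j := hij
    have h : (i : ℕ) < j := hij
    simp [bidiagL, hij.ne, show (i : ℕ) ≠ j + 1 by lia]

theorem ncf_cons_of_ncf_eq_some {a x y : ℚ} {l : List ℚ} (hy : ncf l = some y)
    (hx : ncf (a :: l) = some x) : y ≠ 0 ∧ a = x + 1 / y := by
  cases l with
  | nil => simp [ncf] at hy
  | cons b l =>
    rw [ncf, hy, Option.bind_some] at hx
    split_ifs at hx with h0
    refine ⟨h0, ?_⟩
    rw [← Option.some.inj hx]
    ring

theorem tridiagL_eq (l : List ℚ) (d : Fin l.length → ℚ)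
    (hd : ∀ i : Fin l.length, ncf (l.drop i) = some (d i)) :
    tridiagL l = (bidiagL d)ᵀ * diagonal d * bidiagL d := by
  have hsucc (i k : Fin l.length) (hk : (k : ℕ) = i + 1) : d k ≠ 0 ∧ l.get i = d i + 1 / d k := by
    have hi := hd i
    rw [List.drop_eq_getElem_cons i.isLt, ← hk] at hi
    exact ncf_cons_of_ncf_eq_some (hd k) hi
  have hlast (i : Fin l.length) (h : (i : ℕ) + 1 = l.length) : l.get i = d i := by
    have hi := hd i
    rw [List.drop_eq_getElem_cons i.isLt, List.drop_of_length_le h.ge] at hi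
    exact Option.some.inj hi
  ext i j
  rw [Matrix.mul_apply]
  simp only [Matrix.mul_diagonal, Matrix.transpose_apply, bidiagL,
    Matrix.of_apply, tridiagL, add_mul, Finset.sum_add_distrib, ite_mul, one_mul,
    zero_mul, Finset.sum_ite_eq', Finset.mem_univ, if_true]
  have hj : (i : ℕ) = j + 1 → d i ≠ 0 := fun h => (hsucc j i h).1
  by_cases h : (i : ℕ) + 1 < l.length
  · obtain ⟨k, hk⟩ : ∃ k : Fin l.length, (k : ℕ) = i + 1 := ⟨⟨_, h⟩, rfl⟩
    have hki (x : Fin l.length) : (x : ℕ) = i + 1 ↔ x = k := by rw [Fin.ext_iff, hk]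
    obtain ⟨h0, h1⟩ := hsucc i k hk
    simp only [hki, Finset.sum_ite_eq', Finset.mem_univ, if_true, h1]
    grind
  · have hki (x : Fin l.length) : (x : ℕ) ≠ i + 1 := by lia
    have h1 := hlast i (by lia)
    simp only [hki, if_false, Finset.sum_const_zero, h1]
    grind

theorem isNegDefQ_iff_posDef_neg {V : Type} [Fintype V] [DecidableEq V] {A : Matrix V V ℚ}
    (hA : A.IsSymm) : IsNegDefQ A ↔ (-A.map ((↑) : ℚ → ℝ)).PosDef := by
  have h : (A.map ((↑) : ℚ → ℝ)).IsHermitian := by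
    ext i j
    simp [hA.apply i j]
  have hs := spectrum.neg_eq (R := ℝ) (A.map ((↑) : ℚ → ℝ))
  rw [h.spectrum_real_eq_range_eigenvalues, h.neg.spectrum_real_eq_range_eigenvalues] at hs
  rw [h.neg.posDef_iff_eigenvalues_pos, ← Set.forall_mem_range (p := fun x => 0 < x), ← hs]
  simp only [IsNegDefQ, eigsR, dif_pos h, Set.mem_neg]
  rw [← Set.forall_mem_range (p := fun x => x < 0)]
  exact ⟨fun H x hx => by simpa using H _ hx,
    fun H x hx => by simpa using H (-x) (by simpa using hx)⟩

/-- **Negative definiteness of a linear chain via continued fractions.**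
Let `l = [a₀, …, aₙ]` be a list of rationals and `T = tridiagL l` the
associated symmetric tridiagonal matrix.  If the negative continued fraction
`⟦aᵢ, …, aₙ⟧` is defined for every `i` (with value `d i`), then `T` is negative
definite if and only if `⟦aᵢ, …, aₙ⟧ < 0` for every `i`. -/
theorem tridiag_negdef_iff_ncf_neg
    (l : List ℚ) (hl : l ≠ [])
    (d : Fin l.length → ℚ)
    (hd : ∀ i : Fin l.length, ncf (l.drop i) = some (d i)) :
    IsNegDefQ (tridiagL l) ↔ ∀ i, d i < 0 := by
  have hT := tridiagL_eq l d hd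
  have hsymm : (tridiagL l).IsSymm := by
    rw [hT]
    simp [Matrix.IsSymm, Matrix.mul_assoc]
  have hmap : -(tridiagL l).map ((↑) : ℚ → ℝ) =
      star ((bidiagL d).map ((↑) : ℚ → ℝ)) * diagonal (fun i => -(d i : ℝ)) *
        (bidiagL d).map ((↑) : ℚ → ℝ) := by
    rw [hT]
    change -((bidiagL d)ᵀ * diagonal d * bidiagL d).map (Rat.castHom ℝ) = _
    rw [Matrix.map_mul, Matrix.map_mul, Matrix.diagonal_map (map_zero _), ← Matrix.neg_mul,
      ← Matrix.mul_neg, Matrix.diagonal_neg]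
    rfl
  have hunit : IsUnit ((bidiagL d).map ((↑) : ℚ → ℝ)) := by
    rw [Matrix.isUnit_iff_isUnit_det]
    change IsUnit (((Rat.castHom ℝ).mapMatrix (bidiagL d)).det)
    rw [← RingHom.map_det, det_bidiagL, map_one]
    exact isUnit_one
  rw [isNegDefQ_iff_posDef_neg hsymm, hmap, hunit.posDef_star_left_conjugate_iff,
    Matrix.posDef_diagonal_iff]
  simp
end

section
/- Let a, b be rational numbers and let l be a (possibly empty) list of rational numbers. Whenever both sides are defined, the negative continued fraction satisfies ⟦a + 1, 1, b + 1, l⟧ = ⟦a, b, l⟧. Consequently, applying the Neumann move (A+) along a linear chain of a plumbing tree preserves the negative continued fraction of the weight sequence of that chain. -/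
theorem ncf_cons_cons_eq_some {a b : ℚ} {l : List ℚ} {x : ℚ} :
    ncf (a :: b :: l) = some x ↔ ∃ t, ncf (b :: l) = some t ∧ t ≠ 0 ∧ a - 1 / t = x := by
  simp [ncf, Option.bind_eq_some_iff]

theorem ncf_add_cons (a c : ℚ) (l : List ℚ) :
    ncf ((a + c) :: l) = (ncf (a :: l)).map (· + c) := by
  cases l with
  | nil => simp [ncf]
  | cons b l =>
    ext x
    simp only [ncf_cons_cons_eq_some, Option.map_eq_some_iff]
    constructor
    · rintro ⟨t, ht, ht0, rfl⟩
      exact ⟨a - 1 / t, ⟨t, ht, ht0, rfl⟩, by ring⟩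
    · rintro ⟨_, ⟨t, ht, ht0, rfl⟩, rfl⟩
      exact ⟨t, ht, ht0, by ring⟩

/-- **Neumann move (A+) preserves negative continued fractions.**
Whenever both sides are defined, ⟦a + 1, 1, b + 1, l⟧ = ⟦a, b, l⟧.
Consequently, applying the Neumann move (A+) along a linear chain of a
plumbing tree preserves the negative continued fraction of the weight
sequence of that chain. -/
theorem ncf_move_A_pos (a b : ℚ) (l : List ℚ) (x y : ℚ)
    (h1 : ncf ((a + 1) :: 1 :: (b + 1) :: l) = some x)
    (h2 : ncf (a :: b :: l) = some y) :
    x = y := by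
  obtain ⟨t, ht, ht0, rfl⟩ := ncf_cons_cons_eq_some.1 h2
  obtain ⟨_, hu, -, rfl⟩ := ncf_cons_cons_eq_some.1 h1
  obtain ⟨v, hv, hv0, rfl⟩ := ncf_cons_cons_eq_some.1 hu
  obtain rfl : t + 1 = v := by simpa [ncf_add_cons, ht] using hv
  have key : 1 - 1 / (t + 1) = t / (t + 1) := by
    field_simp
    ring
  rw [key]
  field_simp
  ring
end
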